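/- Let n ≥ 1 and let k1, k2, k3 ≥ 2 be integers with 1/k1 + 1/k2 + 1/k3 < 1, and let Γ = Δ(k1,k2,k3). Let ρ0 : Γ → PSp^±(2n,ℝ) be a homomorphism sending a, b, c to the classes of Lagrangian reflections Refl(L1⁺,L1⁻), Refl(L2⁺,L2⁻), Refl(L3⁺,L3⁻), where the six Lagrangian subspaces L1±, L2±, L3± of (ℝ^{2n}, ω) are pairwise transverse and the cross-ratios are scalar: [L2⁺,L2⁻;L3⁺,L3⁻] = sin²(π/(2k1))·id, [L1⁺,L1⁻;L3⁺,L3⁻] = sin²(π/(2k2))·id, and [L1⁺,L1⁻;L2⁺,L2⁻] = sin²(π/(2k3))·id (these conditions hold for the composition of the geometric representation with any (p,q)-diagonal embedding i_{(p,q)} of PGL(2,ℝ) into PSp^±(2n,ℝ)). Then ρ0 is locally rigid: for every family (ρ_t)_{t ∈ [0,1]} of homomorphisms Γ → PSp^±(2n,ℝ) with ρ_0 = ρ0 such that t ↦ ρ_t(γ) is continuous for every γ ∈ Γ, for each t ∈ [0,1] there exists h ∈ Sp^±(2n,ℝ) with ρ_t(γ) = [h]·ρ0(γ)·[h]⁻¹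 for all γ ∈ Γ. -/

import Mathlib

open Module Submodule

/-- `ℝ^{2n} = ℝⁿ × ℝⁿ`, realized as functions on `Fin n ⊕ Fin n`. -/
abbrev SpV (n : ℕ) := Fin n ⊕ Fin n → ℝ

/-- The standard symplectic form `ω((x,y),(x',y')) = ⟨x,y'⟩ - ⟨y,x'⟩`. -/
def omegaStd (n : ℕ) (u v : SpV n) : ℝ :=
  (∑ i, u (Sum.inl i) * v (Sum.inr i)) - ∑ i, u (Sum.inr i) * v (Sum.inl i)

/-- `Sp^±(2n,ℝ)`: the subgroup of `GL(2n,ℝ)` of elements preserving `ω` up to sign. -/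
def SpPM (n : ℕ) : Subgroup (GL (Fin n ⊕ Fin n) ℝ) where
  carrier := {g | (∀ u v, omegaStd n ((g : GL (Fin n ⊕ Fin n) ℝ).val.mulVec u)
                      ((g : GL (Fin n ⊕ Fin n) ℝ).val.mulVec v) = omegaStd n u v) ∨
                  (∀ u v, omegaStd n ((g : GL (Fin n ⊕ Fin n) ℝ).val.mulVec u)
                      ((g : GL (Fin n ⊕ Fin n) ℝ).val.mulVec v) = - omegaStd n u v)}
  one_mem' := by
    left
    intro u v
    simp [Matrix.one_mulVec]
  mul_mem' := by
    rintro a b (ha | ha) (hb | hb)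
    · left
      intro u v
      simp only [Units.val_mul, ← Matrix.mulVec_mulVec]
      rw [ha, hb]
    · right
      intro u v
      simp only [Units.val_mul, ← Matrix.mulVec_mulVec]
      rw [ha, hb]
    · right
      intro u v
      simp only [Units.val_mul, ← Matrix.mulVec_mulVec]
      rw [ha, hb]
    · left
      intro u v
      simp only [Units.val_mul, ← Matrix.mulVec_mulVec]
      rw [ha, hb, neg_neg]
  inv_mem' := by
    have key : ∀ (a : GL (Fin n ⊕ Fin n) ℝ) (w : SpV n),
        a.val.mulVec ((a⁻¹).val.mulVec w) = w := by
      intro a w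
      rw [Matrix.mulVec_mulVec]
      have h1 : a.val * (a⁻¹).val = 1 := by
        rw [← Units.val_mul, mul_inv_cancel, Units.val_one]
      rw [h1, Matrix.one_mulVec]
    rintro a (ha | ha)
    · left
      intro u v
      have h2 := ha ((a⁻¹).val.mulVec u) ((a⁻¹).val.mulVec v)
      rw [key, key] at h2
      exact h2.symm
    · right
      intro u v
      have h2 := ha ((a⁻¹).val.mulVec u) ((a⁻¹).val.mulVec v)
      rw [key, key] at h2
      linarith

/-- `-I` as an element of `Sp^±(2n,ℝ)`. -/
def negOneSp (n : ℕ) : SpPM n :=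
  ⟨-1, Or.inl (by
    intro u v
    have h : ∀ w : SpV n, ((-1 : GL (Fin n ⊕ Fin n) ℝ)).val.mulVec w = -w := by
      intro w
      simp [Matrix.neg_mulVec, Matrix.one_mulVec]
    rw [h, h]
    simp [omegaStd, neg_mul_neg])⟩

/-- The subgroup `{±I}` of `Sp^±(2n,ℝ)`. -/
def pmOne (n : ℕ) : Subgroup (SpPM n) := Subgroup.zpowers (negOneSp n)

instance pmOne_normal (n : ℕ) : (pmOne n).Normal := by
  constructor
  intro x hx g
  have hcomm : ∀ y : SpPM n, Commute (negOneSp n) y := by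
    intro y
    apply Subtype.ext
    apply Units.ext
    show ((-1 : GL (Fin n ⊕ Fin n) ℝ) * y.val).val = (y.val * (-1 : GL (Fin n ⊕ Fin n) ℝ)).val
    simp [Units.val_mul]
  obtain ⟨k, rfl⟩ := hx
  have h1 : Commute ((negOneSp n) ^ k) g := (hcomm g).zpow_left k
  have : g * (negOneSp n) ^ k * g⁻¹ = (negOneSp n) ^ k := by
    rw [← h1.eq, mul_assoc, mul_inv_cancel, mul_one]
  rw [this]
  exact Subgroup.zpow_mem _ (Subgroup.mem_zpowers _) k

/-- `PSp^±(2n,ℝ) = Sp^±(2n,ℝ)/{±I}`, with the quotient topology. -/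
abbrev PSpPM (n : ℕ) := SpPM n ⧸ pmOne n

/-- A Lagrangian: an `n`-dimensional subspace of `ℝ^{2n}` on which `ω` vanishes. -/
def IsLagrangian (n : ℕ) (L : Submodule ℝ (SpV n)) : Prop :=
  finrank ℝ L = n ∧ ∀ u ∈ L, ∀ v ∈ L, omegaStd n u v = 0

/-- The projection onto `U` with kernel `W`, as an endomorphism of `V`. -/
noncomputable def projTo {V : Type*} [AddCommGroup V] [Module ℝ V]
    (U W : Submodule ℝ V) (h : IsCompl U W) : V →ₗ[ℝ] V :=
  U.subtype ∘ₗ U.linearProjOfIsCompl W h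

/-- The reflection in the pair `(U, W)`: `π_U^W - π_W^U`. -/
noncomputable def reflPair {V : Type*} [AddCommGroup V] [Module ℝ V]
    (U W : Submodule ℝ V) (h : IsCompl U W) : V →ₗ[ℝ] V :=
  projTo U W h - projTo W U h.symm

/-- The generalized cross-ratio `[U1,U2;U3,U4]` as an endomorphism of `U1`. -/
noncomputable def crossRatio {V : Type*} [AddCommGroup V] [Module ℝ V]
    (U1 U2 U3 U4 : Submodule ℝ V)
    (h12 : IsCompl U1 U2) (h34 : IsCompl U3 U4) : U1 →ₗ[ℝ] U1 :=
  (U1.linearProjOfIsCompl U2 h12) ∘ₗ (projTo U3 U4 h34) ∘ₗ U1.subtype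

/-- The relators of the triangle group `Δ(k1,k2,k3)` on generators `a = of 0`,
`b = of 1`, `c = of 2`. -/
def triangleRels (k1 k2 k3 : ℕ) : Set (FreeGroup (Fin 3)) :=
  {(FreeGroup.of 0) ^ 2, (FreeGroup.of 1) ^ 2, (FreeGroup.of 2) ^ 2,
   (FreeGroup.of 0 * FreeGroup.of 1) ^ k1, (FreeGroup.of 1 * FreeGroup.of 2) ^ k2,
   (FreeGroup.of 0 * FreeGroup.of 2) ^ k3}

/-- The triangle group `Δ(k1,k2,k3)`. -/
abbrev TriangleGroup (k1 k2 k3 : ℕ) := PresentedGroup (triangleRels k1 k2 k3)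

/-- A continuous function on a preconnected space with values in a pair of points is constant. -/
theorem eq_left_of_forall_eq_or_eq {X T : Type*} [TopologicalSpace X] [PreconnectedSpace X]
    [TopologicalSpace T] [T1Space T] {f : X → T} (hf : Continuous f) {a b : T} (hab : a ≠ b)
    (h : ∀ x, f x = a ∨ f x = b) {x₀ : X} (h₀ : f x₀ = a) (x : X) : f x = a := by
  have hclopen : IsClopen {x | f x = a} := by
    refine ⟨isClosed_singleton.preimage hf, ?_⟩
    have : {x | f x = a} = {x | f x = b}ᶜ := by
      ext y
      rcases h y with hy | hy <;> simp [hy, hab, hab.symm]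
    rw [this]
    exact (isClosed_singleton.preimage hf).isOpen_compl
  have := hclopen.eq_univ ⟨x₀, h₀⟩
  exact Set.eq_univ_iff_forall.mp this x

open Polynomial in
/-- A polynomial relation satisfied by one member of a continuous family of matrices of finite
order `N` is satisfied by all of them. -/
theorem aeval_eq_zero_of_pow_eq_one {Y m : Type*} [TopologicalSpace Y] [PreconnectedSpace Y]
    [Fintype m] [DecidableEq m] {U : Y → Matrix m m ℝ} (hU : Continuous U) {N : ℕ} (hN : N ≠ 0)
    (hpow : ∀ x, U x ^ N = 1) (q : ℝ[X]) {x₀ : Y} (hq : aeval (U x₀) q = 0)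
    (x : Y) : aeval (U x) q = 0 := by
  have hzero : ∀ y, aeval (U y) (X ^ N - 1 : ℝ[X]) = 0 := fun y => by simp [hpow]
  set p := minpoly ℝ (U x₀) with hp
  obtain ⟨r, hr⟩ : p ∣ (X ^ N - 1 : ℝ[X]) := minpoly.dvd ℝ _ (hzero x₀)
  have hsep : (X ^ N - 1 : ℝ[X]).Separable := by
    rw [X_pow_sub_one_separable_iff]
    exact_mod_cast hN
  obtain ⟨a, b, hab⟩ : IsCoprime p r := by
    rw [hr] at hsep
    exact hsep.isCoprime
  have hidem : ∀ y, aeval (U y) (b * r) * aeval (U y) (b * r) = aeval (U y) (b * r) := fun y => by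
    have : b * r * (b * r) = b * r - a * b * (X ^ N - 1) := by
      rw [hr]; linear_combination (b * r) * hab
    rw [← map_mul, this, map_sub, map_mul _ (a * b), hzero, mul_zero, sub_zero]
  have hcont : Continuous fun y => (aeval (U y) (b * r)).det := by
    refine Continuous.matrix_det ?_
    simp only [aeval_eq_sum_range]
    fun_prop
  have hdet : ∀ y, (aeval (U y) (b * r)).det = 1 := by
    refine eq_left_of_forall_eq_or_eq hcont one_ne_zero (fun y => ?_) (x₀ := x₀) ?_
    · have := congrArg Matrix.det (hidem y)
      rw [Matrix.det_mul] at this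
      exact (IsIdempotentElem.iff_eq_zero_or_one.mp this).symm
    · have : b * r = 1 - a * p := by linear_combination hab
      rw [this]
      simp [hp, minpoly.aeval]
  have hone : aeval (U x) (b * r) = 1 := by
    have hu : IsUnit (aeval (U x) (b * r)) := by
      rw [Matrix.isUnit_iff_isUnit_det, hdet]; exact isUnit_one
    exact hu.mul_left_cancel (by rw [hidem, mul_one])
  have hpx : aeval (U x) p = 0 := by
    have h1 : p * (b * r) = b * (X ^ N - 1) := by rw [hr]; ring
    have := congrArg (aeval (U x)) h1
    rwa [map_mul, hone, mul_one, map_mul, hzero, mul_zero] at this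
  obtain ⟨s, hs⟩ : p ∣ q := minpoly.dvd ℝ _ hq
  rw [hs, map_mul, hpx, zero_mul]

/-- Near `1`, square roots in a Banach algebra exist and are unique. -/
theorem exists_local_sqrt (R : Type*) [NormedRing R] [NormedAlgebra ℝ R] [CompleteSpace R] :
    ∃ σ : R → R, Filter.Tendsto σ (nhds 1) (nhds 1) ∧
      (∀ᶠ s in nhds 1, σ s * σ s = s) ∧ ∀ᶠ r in nhds 1, σ (r * r) = r := by
  let e : R ≃L[ℝ] R := ContinuousLinearEquiv.smulLeft (Units.mk0 (2 : ℝ) two_ne_zero)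
  have hd : HasStrictFDerivAt (fun r : R => r * r) (e : R →L[ℝ] R) 1 := by
    have := (hasStrictFDerivAt_id (𝕜 := ℝ) (1 : R)).mul' (hasStrictFDerivAt_id (𝕜 := ℝ) (1 : R))
    refine this.congr_fderiv ?_
    ext1 y
    change (1 : R) • y + MulOpposite.op (1 : R) • y = (2 : ℝ) • y
    rw [MulOpposite.op_one, one_smul, one_smul, two_smul]
  refine ⟨hd.localInverse _ _ _, ?_, ?_, hd.eventually_left_inverse⟩
  · have := hd.localInverse_tendsto
    rwa [mul_one] at this
  · have := hd.eventually_right_inverse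
    rwa [mul_one] at this

theorem Matrix.exists_local_sqrt (m : Type*) [Fintype m] [DecidableEq m] :
    ∃ σ : Matrix m m ℝ → Matrix m m ℝ, Filter.Tendsto σ (nhds 1) (nhds 1) ∧
      (∀ᶠ s in nhds 1, σ s * σ s = s) ∧ ∀ᶠ r in nhds 1, σ (r * r) = r :=
  let _ : NormedRing (Matrix m m ℝ) := Matrix.linftyOpNormedRing
  let _ : NormedAlgebra ℝ (Matrix m m ℝ) := Matrix.linftyOpNormedAlgebra
  _root_.exists_local_sqrt (Matrix m m ℝ)

/-- The adjoint of a matrix with respect to the standard symplectic form. -/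
def symplAdj (n : ℕ) (X : Matrix (Fin n ⊕ Fin n) (Fin n ⊕ Fin n) ℝ) :
    Matrix (Fin n ⊕ Fin n) (Fin n ⊕ Fin n) ℝ :=
  -(Matrix.J (Fin n) ℝ * X.transpose * Matrix.J (Fin n) ℝ)

section symplAdj

open Matrix

variable {n : ℕ} (X Y : Matrix (Fin n ⊕ Fin n) (Fin n ⊕ Fin n) ℝ)

theorem symplAdj_mul : symplAdj n (X * Y) = symplAdj n Y * symplAdj n X := by
  have hJ := Matrix.J_squared (Fin n) ℝ
  simp only [symplAdj, Matrix.transpose_mul, neg_mul_neg]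
  have : Matrix.J (Fin n) ℝ * Yᵀ * Matrix.J (Fin n) ℝ * (Matrix.J (Fin n) ℝ * Xᵀ * Matrix.J (Fin n) ℝ)
      = Matrix.J (Fin n) ℝ * Yᵀ * (Matrix.J (Fin n) ℝ * Matrix.J (Fin n) ℝ) * Xᵀ
        * Matrix.J (Fin n) ℝ := by
    simp only [mul_assoc]
  rw [this, hJ]
  simp only [mul_neg, neg_mul, mul_one, mul_assoc]

theorem symplAdj_sub : symplAdj n (X - Y) = symplAdj n X - symplAdj n Y := by
  simp only [symplAdj, Matrix.transpose_sub, mul_sub, sub_mul]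
  abel

theorem symplAdj_smul (c : ℝ) : symplAdj n (c • X) = c • symplAdj n X := by
  simp [symplAdj]

theorem symplAdj_one : symplAdj n 1 = 1 := by
  simp [symplAdj, Matrix.J_squared]

theorem symplAdj_symplAdj : symplAdj n (symplAdj n X) = X := by
  have hJ := Matrix.J_squared (Fin n) ℝ
  simp only [symplAdj, Matrix.transpose_neg, Matrix.transpose_mul, Matrix.transpose_transpose,
    Matrix.J_transpose, neg_mul, mul_neg, neg_neg]
  simp only [mul_assoc, hJ]
  rw [← mul_assoc, hJ]
  simp

theorem continuous_symplAdj : Continuous (symplAdj n) := by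
  unfold symplAdj
  fun_prop

theorem omegaStd_eq_dotProduct (u v : SpV n) :
    omegaStd n u v = -(u ⬝ᵥ (Matrix.J (Fin n) ℝ *ᵥ v)) := by
  simp [omegaStd, Matrix.J, dotProduct, Matrix.mulVec, Fintype.sum_sum_type, Matrix.one_apply]
  ring

theorem omegaStd_mulVec_left (u v : SpV n) :
    omegaStd n (X *ᵥ u) v = omegaStd n u (symplAdj n X *ᵥ v) := by
  have hJ := Matrix.J_squared (Fin n) ℝ
  rw [omegaStd_eq_dotProduct, omegaStd_eq_dotProduct, mulVec_mulVec, symplAdj,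
    mul_neg, ← mul_assoc, ← mul_assoc, hJ, dotProduct_comm, dotProduct_mulVec,
    dotProduct_comm, ← mulVec_transpose]
  simp [mulVec_mulVec]

theorem eq_of_forall_omegaStd_eq {X Y : Matrix (Fin n ⊕ Fin n) (Fin n ⊕ Fin n) ℝ}
    (h : ∀ u v, omegaStd n u (X *ᵥ v) = omegaStd n u (Y *ᵥ v)) : X = Y := by
  have hJ := Matrix.J_squared (Fin n) ℝ
  have : Matrix.J (Fin n) ℝ * X = Matrix.J (Fin n) ℝ * Y := by
    apply Matrix.ext_of_mulVec_single
    intro i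
    refine dotProduct_eq _ _ fun u => ?_
    have := h u (Pi.single i 1)
    simp only [omegaStd_eq_dotProduct, mulVec_mulVec, neg_inj] at this
    rw [dotProduct_comm, this, dotProduct_comm]
  have := congrArg (Matrix.J (Fin n) ℝ * ·) this
  simpa [← mul_assoc, hJ] using this

theorem forall_omegaStd_mulVec_eq_iff (c : ℝ) :
    (∀ u v, omegaStd n (X *ᵥ u) (X *ᵥ v) = c * omegaStd n u v) ↔
      symplAdj n X * X = c • 1 := by
  have hc (u v : SpV n) : c * omegaStd n u v = omegaStd n u ((c • 1 : Matrix _ _ ℝ) *ᵥ v) := by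
    rw [omegaStd_eq_dotProduct, omegaStd_eq_dotProduct, smul_mulVec, one_mulVec, mulVec_smul,
      dotProduct_smul, smul_eq_mul, mul_neg]
  simp only [omegaStd_mulVec_left, mulVec_mulVec, hc]
  exact ⟨eq_of_forall_omegaStd_eq, fun h u v => by rw [h]⟩

end symplAdj

theorem mem_SpPM_iff {n : ℕ} (g : GL (Fin n ⊕ Fin n) ℝ) :
    g ∈ SpPM n ↔ symplAdj n g.val * g.val = 1 ∨ symplAdj n g.val * g.val = -1 := by
  have h₁ := forall_omegaStd_mulVec_eq_iff g.val 1
  have h₂ := forall_omegaStd_mulVec_eq_iff g.val (-1)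
  simp only [one_mul, one_smul] at h₁
  simp only [neg_mul, one_mul, neg_smul, one_smul] at h₂
  rw [← h₁, ← h₂]
  rfl

/-- Let `F` be matrices with `F * F = δ ≠ 0`, `F' * F' = δ`. Averaging over the group generated by
`F` and `F'` yields an intertwiner. -/
noncomputable def avgConj {m : Type*} [Fintype m] (δ : ℝ) (F F' X : Matrix m m ℝ) : Matrix m m ℝ :=
  (2⁻¹ : ℝ) • (X + δ⁻¹ • (F * X * F'))

section avgConj

variable {m : Type*} [Fintype m] [DecidableEq m] {δ : ℝ} {F F' G G' X : Matrix m m ℝ}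

theorem mul_avgConj (hδ : δ ≠ 0) (hF : F * F = δ • 1) (hF' : F' * F' = δ • 1) :
    F * avgConj δ F F' X = avgConj δ F F' X * F' := by
  simp only [avgConj, mul_smul_comm, smul_mul_assoc, mul_add, add_mul, ← mul_assoc, hF]
  simp only [mul_assoc, hF', mul_smul_comm, one_mul, mul_one, smul_smul,
    inv_mul_cancel₀ hδ, one_smul, add_comm]

/-- Anticommuting pairs preserve the intertwining property under averaging. -/
theorem mul_avgConj_of_anticomm (hFG : F * G = -(G * F)) (hFG' : F' * G' = -(G' * F'))
    (hX : G * X = X * G') : G * avgConj δ F F' X = avgConj δ F F' X * G' := by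
  have : G * (F * X * F') = F * X * F' * G' := by
    rw [← mul_assoc, ← mul_assoc, ← neg_eq_iff_eq_neg.mpr hFG, mul_assoc _ F', hFG',
      neg_mul, neg_mul, mul_neg, mul_assoc F, hX]
    simp only [mul_assoc]
  simp only [avgConj, mul_smul_comm, smul_mul_assoc, mul_add, add_mul, this, hX]

theorem avgConj_self (hδ : δ ≠ 0) (hF : F * F = δ • 1) : avgConj δ F F 1 = 1 := by
  rw [avgConj, mul_one, hF, smul_smul, inv_mul_cancel₀ hδ, one_smul, ← two_smul ℝ, smul_smul]
  norm_num

end avgConj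

theorem mul_comm_of_local_sqrt {m : Type*} [Fintype m] [DecidableEq m] {δ : ℝ}
    {f S r : Matrix m m ℝ} {σ : Matrix m m ℝ → Matrix m m ℝ} (hδ : δ ≠ 0) (hf : f * f = δ • 1)
    (hS : f * S = S * f) (hr : r * r = S) (hσ : σ S = r)
    (h : σ ((δ⁻¹ • (f * r * f)) * (δ⁻¹ • (f * r * f))) = δ⁻¹ • (f * r * f)) :
    f * r = r * f := by
  have h1 : (δ⁻¹ • (f * r * f)) * (δ⁻¹ • (f * r * f)) = S := by
    have : f * r * f * (f * r * f) = δ • (f * S * f) := by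
      rw [show f * r * f * (f * r * f) = f * r * (f * f) * r * f by simp only [mul_assoc], hf, ← hr]
      simp only [mul_smul_comm, smul_mul_assoc, mul_one, mul_assoc]
    rw [smul_mul_smul_comm, this, hS, mul_assoc S, hf, mul_smul_comm, mul_one, smul_smul, smul_smul]
    rw [show δ⁻¹ * δ⁻¹ * δ * δ = 1 by field_simp, one_smul]
  rw [h1, hσ] at h
  nth_rewrite 1 [h]
  rw [mul_smul_comm, ← mul_assoc, ← mul_assoc, hf, smul_mul_assoc, one_mul, smul_mul_assoc,
    smul_smul, inv_mul_cancel₀ hδ, one_smul]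

/-- Continuous families of symplectic-skew representations of a Clifford algebra are locally
conjugate under the symplectic group. -/
theorem eventually_conj_of_clifford {n : ℕ} {Y : Type*} [TopologicalSpace Y]
    {F₁ F₂ F₃ : Y → Matrix (Fin n ⊕ Fin n) (Fin n ⊕ Fin n) ℝ} {δ₁ δ₂ δ₃ : ℝ}
    (c₁ : Continuous F₁) (c₂ : Continuous F₂) (c₃ : Continuous F₃)
    (hδ₁ : δ₁ ≠ 0) (hδ₂ : δ₂ ≠ 0) (hδ₃ : δ₃ ≠ 0)
    (h₁ : ∀ y, F₁ y * F₁ y = δ₁ • 1) (h₂ : ∀ y, F₂ y * F₂ y = δ₂ • 1)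
    (h₃ : ∀ y, F₃ y * F₃ y = δ₃ • 1)
    (h₂₁ : ∀ y, F₂ y * F₁ y = -(F₁ y * F₂ y)) (h₃₁ : ∀ y, F₃ y * F₁ y = -(F₁ y * F₃ y))
    (h₃₂ : ∀ y, F₃ y * F₂ y = -(F₂ y * F₃ y))
    (s₁ : ∀ y, symplAdj n (F₁ y) = -F₁ y) (s₂ : ∀ y, symplAdj n (F₂ y) = -F₂ y)
    (s₃ : ∀ y, symplAdj n (F₃ y) = -F₃ y) (y₀ : Y) :
    ∀ᶠ y in nhds y₀, ∃ h, symplAdj n h * h = 1 ∧ F₁ y * h = h * F₁ y₀ ∧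
      F₂ y * h = h * F₂ y₀ ∧ F₃ y * h = h * F₃ y₀ := by
  obtain ⟨σ, hσ, hσ_sq, hσ_left⟩ := Matrix.exists_local_sqrt (Fin n ⊕ Fin n)
  set H := fun y => avgConj δ₃ (F₃ y) (F₃ y₀) (avgConj δ₂ (F₂ y) (F₂ y₀)
    (avgConj δ₁ (F₁ y) (F₁ y₀) 1)) with hH
  have H₀ : H y₀ = 1 := by
    simp only [hH, avgConj_self, hδ₁, hδ₂, hδ₃, h₁, h₂, h₃, ne_eq, not_false_eq_true]
  have H₁ (y) : F₁ y * H y = H y * F₁ y₀ :=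
    mul_avgConj_of_anticomm (h₃₁ y) (h₃₁ y₀) <| mul_avgConj_of_anticomm (h₂₁ y) (h₂₁ y₀) <|
      mul_avgConj hδ₁ (h₁ y) (h₁ y₀)
  have H₂ (y) : F₂ y * H y = H y * F₂ y₀ :=
    mul_avgConj_of_anticomm (h₃₂ y) (h₃₂ y₀) <| mul_avgConj hδ₂ (h₂ y) (h₂ y₀)
  have H₃ (y) : F₃ y * H y = H y * F₃ y₀ := mul_avgConj hδ₃ (h₃ y) (h₃ y₀)
  have Hcont : Continuous H := by
    simp only [hH, avgConj]
    fun_prop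
  set S := fun y => symplAdj n (H y) * H y with hS
  have Scont : Continuous S := (continuous_symplAdj.comp Hcont).mul Hcont
  have S₀ : S y₀ = 1 := by simp only [hS, H₀, symplAdj_one, mul_one]
  have Stend : Filter.Tendsto S (nhds y₀) (nhds 1) := S₀ ▸ Scont.tendsto y₀
  have hcomm {y : Y} {f f₀ : Matrix (Fin n ⊕ Fin n) (Fin n ⊕ Fin n) ℝ}
      (hf : symplAdj n f = -f) (hf₀ : symplAdj n f₀ = -f₀) (h : f * H y = H y * f₀) :
      f₀ * S y = S y * f₀ := by
    have h' := congrArg (symplAdj n) h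
    rw [symplAdj_mul, symplAdj_mul, hf, hf₀, neg_mul, mul_neg, neg_inj] at h'
    simp only [hS]
    rw [← mul_assoc, ← h', mul_assoc, h, mul_assoc]
  have rtend : Filter.Tendsto (fun y => σ (S y)) (nhds y₀) (nhds 1) := hσ.comp Stend
  have conj_tend {δ : ℝ} {f : Matrix (Fin n ⊕ Fin n) (Fin n ⊕ Fin n) ℝ} (hδ : δ ≠ 0)
      (hf : f * f = δ • 1) :
      Filter.Tendsto (fun y => δ⁻¹ • (f * σ (S y) * f)) (nhds y₀) (nhds 1) := by
    have : Continuous fun X : Matrix (Fin n ⊕ Fin n) (Fin n ⊕ Fin n) ℝ => δ⁻¹ • (f * X * f) := by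
      fun_prop
    have := (this.tendsto 1).comp rtend
    rwa [mul_one, hf, smul_smul, inv_mul_cancel₀ hδ, one_smul] at this
  have adj_tend : Filter.Tendsto (fun y => symplAdj n (σ (S y))) (nhds y₀) (nhds 1) := by
    have := (continuous_symplAdj.tendsto (1 : Matrix (Fin n ⊕ Fin n) (Fin n ⊕ Fin n) ℝ)).comp rtend
    rwa [symplAdj_one] at this
  have unit_ev : ∀ᶠ r : Matrix (Fin n ⊕ Fin n) (Fin n ⊕ Fin n) ℝ in nhds 1, r.det ≠ 0 := by
    have : Continuous fun r : Matrix (Fin n ⊕ Fin n) (Fin n ⊕ Fin n) ℝ => r.det := by fun_prop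
    exact this.continuousAt.eventually_ne (by simp)
  filter_upwards [Stend.eventually hσ_sq, rtend.eventually unit_ev, adj_tend.eventually hσ_left,
    (conj_tend hδ₁ (h₁ y₀)).eventually hσ_left, (conj_tend hδ₂ (h₂ y₀)).eventually hσ_left,
    (conj_tend hδ₃ (h₃ y₀)).eventually hσ_left] with y hsq hdet hadj e₁ e₂ e₃
  set r := σ (S y) with hr
  have r₁ : F₁ y₀ * r = r * F₁ y₀ := mul_comm_of_local_sqrt hδ₁ (h₁ y₀)
    (hcomm (s₁ y) (s₁ y₀) (H₁ y)) hsq rfl e₁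
  have r₂ : F₂ y₀ * r = r * F₂ y₀ := mul_comm_of_local_sqrt hδ₂ (h₂ y₀)
    (hcomm (s₂ y) (s₂ y₀) (H₂ y)) hsq rfl e₂
  have r₃ : F₃ y₀ * r = r * F₃ y₀ := mul_comm_of_local_sqrt hδ₃ (h₃ y₀)
    (hcomm (s₃ y) (s₃ y₀) (H₃ y)) hsq rfl e₃
  have radj : symplAdj n r = r := by
    rw [← symplAdj_mul, hsq, hS] at hadj
    simp only [symplAdj_mul, symplAdj_symplAdj] at hadj
    exact hadj.symm
  have hu : IsUnit r.det := isUnit_iff_ne_zero.mpr hdet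
  have inv_comm {f f₀ : Matrix (Fin n ⊕ Fin n) (Fin n ⊕ Fin n) ℝ} (hf : f * H y = H y * f₀)
      (hf₀ : f₀ * r = r * f₀) : f * (H y * r⁻¹) = H y * r⁻¹ * f₀ := by
    have : f₀ * r⁻¹ = r⁻¹ * f₀ := by
      rw [← Matrix.mul_nonsing_inv_cancel_right r (r⁻¹ * f₀) hu, mul_assoc r⁻¹, hf₀, ← mul_assoc,
        Matrix.nonsing_inv_mul r hu, one_mul]
    rw [← mul_assoc, hf, mul_assoc, this, mul_assoc]
  have rinv_adj : symplAdj n r⁻¹ * r = 1 := by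
    rw [← radj, ← symplAdj_mul, radj, Matrix.mul_nonsing_inv r hu, symplAdj_one]
  refine ⟨H y * r⁻¹, ?_, inv_comm (H₁ y) r₁, inv_comm (H₂ y) r₂, inv_comm (H₃ y) r₃⟩
  rw [symplAdj_mul, mul_assoc, ← mul_assoc (symplAdj n (H y))]
  change symplAdj n r⁻¹ * (S y * r⁻¹) = 1
  rw [← hsq, mul_assoc r,
    Matrix.mul_nonsing_inv r hu, mul_one, rinv_adj]

/-- Continuous families of triples of antisymplectic involutions with fixed nondegenerate Gram
matrix are locally conjugate under the symplectic group. -/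
theorem eventually_conj_of_involutions {n : ℕ} {Y : Type*} [TopologicalSpace Y]
    {A B C : Y → Matrix (Fin n ⊕ Fin n) (Fin n ⊕ Fin n) ℝ} {p q s : ℝ}
    (cA : Continuous A) (cB : Continuous B) (cC : Continuous C)
    (hA : ∀ y, A y * A y = 1) (hB : ∀ y, B y * B y = 1) (hC : ∀ y, C y * C y = 1)
    (sA : ∀ y, symplAdj n (A y) = -A y) (sB : ∀ y, symplAdj n (B y) = -B y)
    (sC : ∀ y, symplAdj n (C y) = -C y)
    (hAB : ∀ y, A y * B y + B y * A y = (2 * p) • 1)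
    (hAC : ∀ y, A y * C y + C y * A y = (2 * q) • 1)
    (hBC : ∀ y, B y * C y + C y * B y = (2 * s) • 1)
    (hp : 1 - p ^ 2 ≠ 0) (hD : 1 + 2 * p * q * s - p ^ 2 - q ^ 2 - s ^ 2 ≠ 0) (y₀ : Y) :
    ∀ᶠ y in nhds y₀, ∃ h, symplAdj n h * h = 1 ∧ A y * h = h * A y₀ ∧
      B y * h = h * B y₀ ∧ C y * h = h * C y₀ := by
  set β := (s - p * q) / (1 - p ^ 2) with hβ
  have hβ' : β * (1 - p ^ 2) = s - p * q := by rw [hβ]; field_simp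
  have hδ : 1 - q ^ 2 - β ^ 2 * (1 - p ^ 2) ≠ 0 := by
    intro h0
    apply hD
    linear_combination (1 - p ^ 2) * h0 + (β * (1 - p ^ 2) + s - p * q) * hβ'
  have hBA (y) : B y * A y = (2 * p) • 1 - A y * B y := eq_sub_of_add_eq' (hAB y)
  have hCA (y) : C y * A y = (2 * q) • 1 - A y * C y := eq_sub_of_add_eq' (hAC y)
  have hCB (y) : C y * B y = (2 * s) • 1 - B y * C y := eq_sub_of_add_eq' (hBC y)
  have key := eventually_conj_of_clifford (F₁ := A) (F₂ := fun y => B y - p • A y)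
    (F₃ := fun y => C y - q • A y - β • (B y - p • A y)) (δ₁ := 1) (δ₂ := 1 - p ^ 2)
    (δ₃ := 1 - q ^ 2 - β ^ 2 * (1 - p ^ 2)) cA (by fun_prop) (by fun_prop) one_ne_zero hp hδ
    (fun y => by rw [hA, one_smul])
    (fun y => by
      simp only [sub_mul, mul_sub, smul_mul_assoc, mul_smul_comm, hA, hB, hBA]
      module)
    (fun y => by
      simp only [sub_mul, mul_sub, smul_mul_assoc, mul_smul_comm, hA, hB, hC, hBA, hCA, hCB]
      match_scalars <;> first | ring1 | linear_combination (2 * β) * hβ')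
    (fun y => by
      simp only [sub_mul, mul_sub, smul_mul_assoc, mul_smul_comm, hA, hBA]
      module)
    (fun y => by
      simp only [sub_mul, mul_sub, smul_mul_assoc, mul_smul_comm, hA, hBA, hCA]
      module)
    (fun y => by
      simp only [sub_mul, mul_sub, smul_mul_assoc, mul_smul_comm, hA, hB, hBA, hCA, hCB]
      match_scalars <;> first | ring1 | linear_combination (-2) * hβ')
    sA
    (fun y => by simp only [symplAdj_sub, symplAdj_smul, sA, sB]; module)
    (fun y => by simp only [symplAdj_sub, symplAdj_smul, sA, sB, sC]; module) y₀
  filter_upwards [key] with y hy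
  obtain ⟨h, h₀, h₁, h₂, h₃⟩ := hy
  have h₂' : B y * h = h * B y₀ := by
    rw [sub_mul, mul_sub, smul_mul_assoc, mul_smul_comm, h₁] at h₂
    exact sub_left_injective h₂
  refine ⟨h, h₀, h₁, h₂', ?_⟩
  simp only [sub_mul, mul_sub, smul_mul_assoc, mul_smul_comm, h₁, h₂'] at h₃
  exact sub_left_injective (sub_left_injective h₃)

/-- Over a preconnected base the conjugacy of `eventually_conj_of_involutions` is global. -/
theorem exists_conj_of_involutions {n : ℕ} {Y : Type*} [TopologicalSpace Y] [PreconnectedSpace Y]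
    {A B C : Y → Matrix (Fin n ⊕ Fin n) (Fin n ⊕ Fin n) ℝ} {p q s : ℝ}
    (cA : Continuous A) (cB : Continuous B) (cC : Continuous C)
    (hA : ∀ y, A y * A y = 1) (hB : ∀ y, B y * B y = 1) (hC : ∀ y, C y * C y = 1)
    (sA : ∀ y, symplAdj n (A y) = -A y) (sB : ∀ y, symplAdj n (B y) = -B y)
    (sC : ∀ y, symplAdj n (C y) = -C y)
    (hAB : ∀ y, A y * B y + B y * A y = (2 * p) • 1)
    (hAC : ∀ y, A y * C y + C y * A y = (2 * q) • 1)
    (hBC : ∀ y, B y * C y + C y * B y = (2 * s) • 1)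
    (hp : 1 - p ^ 2 ≠ 0) (hD : 1 + 2 * p * q * s - p ^ 2 - q ^ 2 - s ^ 2 ≠ 0) (y₀ y : Y) :
    ∃ h, symplAdj n h * h = 1 ∧ A y * h = h * A y₀ ∧ B y * h = h * B y₀ ∧ C y * h = h * C y₀ := by
  let P : Y → Y → Prop := fun y₀ y => ∃ h, symplAdj n h * h = 1 ∧ A y * h = h * A y₀ ∧
    B y * h = h * B y₀ ∧ C y * h = h * C y₀
  have : Std.Symm P := ⟨by
    rintro y₀ y ⟨h, h₀, h₁, h₂, h₃⟩
    have h₀' : h * symplAdj n h = 1 := mul_eq_one_comm.mp h₀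
    have aux {f f₀ : Matrix (Fin n ⊕ Fin n) (Fin n ⊕ Fin n) ℝ} (hf : f * h = h * f₀) :
        f₀ * symplAdj n h = symplAdj n h * f := by
      rw [← one_mul f₀, ← h₀, mul_assoc _ h, ← hf, mul_assoc, mul_assoc, h₀', mul_one]
    exact ⟨symplAdj n h, by rw [symplAdj_symplAdj, h₀'], aux h₁, aux h₂, aux h₃⟩⟩
  have : IsTrans Y P := ⟨by
    rintro x y z ⟨h, h₀, h₁, h₂, h₃⟩ ⟨g, g₀, g₁, g₂, g₃⟩
    have aux {f f₀ f₁ : Matrix (Fin n ⊕ Fin n) (Fin n ⊕ Fin n) ℝ} (hf : f * g = g * f₀)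
        (hf₀ : f₀ * h = h * f₁) : f * (g * h) = g * h * f₁ := by
      rw [← mul_assoc, hf, mul_assoc, hf₀, mul_assoc]
    refine ⟨g * h, ?_, aux g₁ h₁, aux g₂ h₂, aux g₃ h₃⟩
    rw [symplAdj_mul, mul_assoc, ← mul_assoc (symplAdj n g), g₀, one_mul, h₀]⟩
  exact PreconnectedSpace.induction₂ P
    (eventually_conj_of_involutions cA cB cC hA hB hC sA sB sC hAB hAC hBC hp hD)
    ‹IsTrans Y P› y₀ y

theorem gram_det_neg {a b c : ℝ} (ha : 0 < a) (hb : 0 < b) (hc : 0 < c) (h : a + b + c < Real.pi) :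
    1 - 2 * Real.cos a * Real.cos b * Real.cos c - Real.cos a ^ 2 - Real.cos b ^ 2
      - Real.cos c ^ 2 < 0 := by
  have hsa : 0 < Real.sin a := Real.sin_pos_of_pos_of_lt_pi ha (by linarith)
  have hsb : 0 < Real.sin b := Real.sin_pos_of_pos_of_lt_pi hb (by linarith)
  have hcos : Real.cos (Real.pi - (a + b)) < Real.cos c :=
    Real.cos_lt_cos_of_nonneg_of_le_pi hc.le (by linarith) (by linarith)
  rw [Real.cos_pi_sub, Real.cos_add] at hcos
  have hlt : Real.sin a * Real.sin b < Real.cos c + Real.cos a * Real.cos b := by linarith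
  have hsq := pow_lt_pow_left₀ hlt (by positivity) two_ne_zero
  rw [mul_pow, Real.sin_sq, Real.sin_sq] at hsq
  linarith

theorem two_mul_sin_sq_half_sub_one (x : ℝ) (k : ℕ) :
    2 * (2 * Real.sin (x / (2 * k)) ^ 2 - 1) = 2 * -Real.cos (x / k) := by
  have : x / k = 2 * (x / (2 * k)) := by
    rcases eq_or_ne (k : ℝ) 0 with h | h
    · simp [h]
    · field_simp
  rw [this, Real.cos_two_mul, Real.sin_sq]
  ring

/-- The anticommutator of the matrices of two antisymplectic reflections with scalar cross-ratio. -/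
theorem anticomm_of_crossRatio {n : ℕ} {P Q : Matrix (Fin n ⊕ Fin n) (Fin n ⊕ Fin n) ℝ} {c : ℝ}
    (hP : P * P = P) (sP : symplAdj n P = 1 - P) (sQ : symplAdj n Q = 1 - Q)
    (h : P * Q * P = c • P) :
    (P - (1 - P)) * (Q - (1 - Q)) + (Q - (1 - Q)) * (P - (1 - P)) = (2 * (2 * c - 1)) • 1 := by
  have h' := congrArg (symplAdj n) h
  rw [symplAdj_mul, symplAdj_mul, symplAdj_smul, sP, sQ] at h'
  have expand : (1 - P) * ((1 - Q) * (1 - P)) = 1 - P - Q + P * Q + Q * P - P * Q * P := by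
    simp only [sub_mul, mul_sub, one_mul, mul_one, ← mul_assoc, hP]
    abel
  rw [expand, h] at h'
  have h'' : P * Q + Q * P = c • 1 - 1 + P + Q := by
    have : P * Q + Q * P = 1 - P - Q + P * Q + Q * P - c • P + c • P - 1 + P + Q := by abel
    rw [this, h']
    module
  have : (P - (1 - P)) * (Q - (1 - Q)) + (Q - (1 - Q)) * (P - (1 - P))
      = (4 : ℝ) • (P * Q + Q * P) - (4 : ℝ) • P - (4 : ℝ) • Q + (2 : ℝ) • 1 := by
    simp only [mul_sub, sub_mul, mul_one, one_mul]
    module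
  rw [this, h'']
  module

theorem isDiscrete_pmOne (n : ℕ) : IsDiscrete (pmOne n : Set (SpPM n)) := by
  have : negOneSp n * negOneSp n = 1 := by
    apply Subtype.ext
    change (-1 : GL (Fin n ⊕ Fin n) ℝ) * -1 = 1
    simp
  have hfin : IsOfFinOrder (negOneSp n) :=
    isOfFinOrder_iff_pow_eq_one.mpr ⟨2, two_pos, by rw [pow_two, this]⟩
  have : Finite (pmOne n) := hfin.finite_zpowers
  exact ⟨inferInstanceAs (DiscreteTopology (pmOne n))⟩

theorem isCoveringMap_mk_pmOne (n : ℕ) :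
    IsCoveringMap (QuotientGroup.mk : SpPM n → PSpPM n) :=
  ((pmOne n).isQuotientCoveringMap (isDiscrete_pmOne n)).isCoveringMap

theorem val_eq_or_of_mk_eq_one {n : ℕ} {g : SpPM n} (h : (QuotientGroup.mk g : PSpPM n) = 1) :
    g.1.val = 1 ∨ g.1.val = -1 := by
  have hg : g ∈ pmOne n := (QuotientGroup.eq_one_iff g).mp h
  obtain ⟨k, rfl⟩ := hg
  have : (negOneSp n ^ k : SpPM n).1 = (-1 : GL (Fin n ⊕ Fin n) ℝ) ^ k := by
    rw [SubgroupClass.coe_zpow]; rfl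
  rcases Int.even_or_odd k with hk | hk
  · left
    rw [this, hk.neg_one_zpow]; rfl
  · right
    rw [this, hk.neg_one_zpow]; rfl

theorem SpPM.continuous_val {n : ℕ} : Continuous fun g : SpPM n => g.1.val :=
  Units.continuous_val.comp continuous_subtype_val

section projTo

variable {V : Type*} [AddCommGroup V] [Module ℝ V] {U W : Submodule ℝ V} (h : IsCompl U W)

theorem projTo_mem (v : V) : projTo U W h v ∈ U := by
  simp [projTo]

theorem projTo_of_mem {v : V} (hv : v ∈ U) : projTo U W h v = v := by
  have := Submodule.projectionOnto_apply_left h ⟨v, hv⟩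
  exact congrArg Subtype.val this

theorem projTo_add (v : V) : projTo U W h v + projTo W U h.symm v = v :=
  Submodule.projection_add_projection_eq_self h v

end projTo

open Matrix in
theorem symplAdj_toMatrix_projTo {n : ℕ} {U W : Submodule ℝ (SpV n)} (hU : IsLagrangian n U)
    (hW : IsLagrangian n W) (h : IsCompl U W) :
    symplAdj n (LinearMap.toMatrix' (projTo U W h))
      = 1 - LinearMap.toMatrix' (projTo U W h) := by
  refine eq_of_forall_omegaStd_eq fun u v => ?_
  have add_left (a b c : SpV n) : omegaStd n (a + b) c = omegaStd n a c + omegaStd n b c := by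
    simp only [omegaStd_eq_dotProduct, add_dotProduct]; ring
  have add_right (a b c : SpV n) : omegaStd n a (b + c) = omegaStd n a b + omegaStd n a c := by
    simp only [omegaStd_eq_dotProduct, mulVec_add, dotProduct_add]; ring
  rw [← omegaStd_mulVec_left, sub_mulVec, one_mulVec, LinearMap.toMatrix'_mulVec,
    LinearMap.toMatrix'_mulVec]
  have hv : v - projTo U W h v = projTo W U h.symm v := by
    rw [sub_eq_iff_eq_add', projTo_add]
  rw [hv]
  have e₁ := add_right (projTo U W h u) (projTo U W h v) (projTo W U h.symm v)
  have e₂ := add_left (projTo U W h u) (projTo W U h.symm u) (projTo W U h.symm v)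
  rw [projTo_add, hU.2 _ (projTo_mem h u) _ (projTo_mem h v), zero_add] at e₁
  rw [projTo_add, hW.2 _ (projTo_mem h.symm u) _ (projTo_mem h.symm v), add_zero] at e₂
  rw [e₁, e₂]

theorem toMatrix_reflPair {n : ℕ} {U W : Submodule ℝ (SpV n)} (h : IsCompl U W) :
    LinearMap.toMatrix' (reflPair U W h) = LinearMap.toMatrix' (projTo U W h)
      - (1 - LinearMap.toMatrix' (projTo U W h)) := by
  have : projTo W U h.symm = LinearMap.id - projTo U W h := by
    refine LinearMap.ext fun v => ?_
    simp only [LinearMap.sub_apply, LinearMap.id_apply]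
    rw [eq_sub_iff_add_eq', projTo_add]
  rw [reflPair, this, map_sub, map_sub, LinearMap.toMatrix'_id]

theorem toMatrix_projTo_mul_self {n : ℕ} {U W : Submodule ℝ (SpV n)} (h : IsCompl U W) :
    LinearMap.toMatrix' (projTo U W h) * LinearMap.toMatrix' (projTo U W h)
      = LinearMap.toMatrix' (projTo U W h) := by
  rw [← LinearMap.toMatrix'_mul]
  congr 1
  refine LinearMap.ext fun v => ?_
  exact projTo_of_mem h (projTo_mem h v)

theorem toMatrix_reflPair_anticomm {n : ℕ} {U₁ U₂ U₃ U₄ : Submodule ℝ (SpV n)}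
    (h₁ : IsLagrangian n U₁) (h₂ : IsLagrangian n U₂) (h₃ : IsLagrangian n U₃)
    (h₄ : IsLagrangian n U₄) (h₁₂ : IsCompl U₁ U₂) (h₃₄ : IsCompl U₃ U₄) {c : ℝ}
    (h : crossRatio U₁ U₂ U₃ U₄ h₁₂ h₃₄ = c • LinearMap.id) :
    LinearMap.toMatrix' (reflPair U₁ U₂ h₁₂) * LinearMap.toMatrix' (reflPair U₃ U₄ h₃₄)
      + LinearMap.toMatrix' (reflPair U₃ U₄ h₃₄) * LinearMap.toMatrix' (reflPair U₁ U₂ h₁₂)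
      = (2 * (2 * c - 1)) • 1 := by
  rw [toMatrix_reflPair, toMatrix_reflPair]
  refine anticomm_of_crossRatio (toMatrix_projTo_mul_self h₁₂) (symplAdj_toMatrix_projTo h₁ h₂ h₁₂)
    (symplAdj_toMatrix_projTo h₃ h₄ h₃₄) ?_
  rw [← LinearMap.toMatrix'_mul, ← LinearMap.toMatrix'_mul, ← map_smul]
  congr 1
  refine LinearMap.ext fun v => ?_
  exact congrArg Subtype.val (LinearMap.congr_fun h ⟨projTo U₁ U₂ h₁₂ v, projTo_mem h₁₂ v⟩)

theorem toMatrix_reflPair_mul_self {n : ℕ} {U W : Submodule ℝ (SpV n)} (h : IsCompl U W) :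
    LinearMap.toMatrix' (reflPair U W h) * LinearMap.toMatrix' (reflPair U W h) = 1 := by
  rw [toMatrix_reflPair]
  simp only [sub_mul, mul_sub, one_mul, mul_one, toMatrix_projTo_mul_self]
  abel

theorem symplAdj_toMatrix_reflPair {n : ℕ} {U W : Submodule ℝ (SpV n)} (hU : IsLagrangian n U)
    (hW : IsLagrangian n W) (h : IsCompl U W) :
    symplAdj n (LinearMap.toMatrix' (reflPair U W h))
      = -LinearMap.toMatrix' (reflPair U W h) := by
  rw [toMatrix_reflPair, symplAdj_sub, symplAdj_sub, symplAdj_one,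
    symplAdj_toMatrix_projTo hU hW h]
  abel

open Polynomial in
/-- Products of two involutions in a continuous family have constant
anticommutator as soon as they have bounded order. -/
theorem anticomm_const {Y m : Type*} [TopologicalSpace Y] [PreconnectedSpace Y] [Fintype m]
    [DecidableEq m] {A B : Y → Matrix m m ℝ} (cA : Continuous A) (cB : Continuous B)
    (hA : ∀ y, A y * A y = 1) (hB : ∀ y, B y * B y = 1) {N : ℕ} (hN : N ≠ 0)
    (hpow : ∀ y, (A y * B y) ^ N = 1) {τ : ℝ} {y₀ : Y}
    (h₀ : A y₀ * B y₀ + B y₀ * A y₀ = τ • 1) (y : Y) : A y * B y + B y * A y = τ • 1 := by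
  have hinv (y) : A y * B y * (B y * A y) = 1 := by
    rw [mul_assoc, ← mul_assoc (B y), hB, one_mul, hA]
  have hinv' (y) : B y * A y * (A y * B y) = 1 := mul_eq_one_comm.mp (hinv y)
  have eval (y) : aeval (A y * B y) (X ^ 2 - C τ * X + 1 : ℝ[X])
      = A y * B y * (A y * B y + B y * A y - τ • 1) := by
    simp only [map_add, map_sub, map_mul, aeval_X, aeval_C, map_one,
      Algebra.algebraMap_eq_smul_one, mul_sub, mul_add, hinv, smul_mul_assoc, one_mul,
      mul_smul_comm, mul_one, pow_two]
    abel
  have := aeval_eq_zero_of_pow_eq_one (U := fun y => A y * B y)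
    (cA.mul cB) hN hpow (X ^ 2 - C τ * X + 1) (x₀ := y₀) (by rw [eval, h₀, sub_self, mul_zero]) y
  rw [eval] at this
  have := congrArg (B y * A y * ·) this
  rw [← mul_assoc, hinv', one_mul, mul_zero, sub_eq_zero] at this
  exact this

theorem one_ne_neg_one_matrix {n : ℕ} (hn : 1 ≤ n) :
    (1 : Matrix (Fin n ⊕ Fin n) (Fin n ⊕ Fin n) ℝ) ≠ -1 := by
  intro h
  have := congrFun (congrFun h (Sum.inl ⟨0, hn⟩)) (Sum.inl ⟨0, hn⟩)
  simp only [Matrix.neg_apply, Matrix.one_apply_eq] at this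
  linarith

/-- A path of involutions in `PSp^±` starting at the class of a Lagrangian reflection lifts to a path
of antisymplectic involutions. -/
theorem exists_lift_of_involutions {n : ℕ} (hn : 1 ≤ n) {φ : unitInterval → PSpPM n}
    (cφ : Continuous φ) (hφ : ∀ t, φ t * φ t = 1) {g : SpPM n} (hg : φ 0 = QuotientGroup.mk g)
    (hg₁ : g.1.val * g.1.val = 1) (hg₂ : symplAdj n g.1.val = -g.1.val) :
    ∃ G : unitInterval → SpPM n, Continuous G ∧ G 0 = g ∧ (∀ t, QuotientGroup.mk (G t) = φ t) ∧
      (∀ t, (G t).1.val * (G t).1.val = 1) ∧ ∀ t, symplAdj n (G t).1.val = -(G t).1.val := by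
  obtain ⟨G, hG, hG₀⟩ := (isCoveringMap_mk_pmOne n).exists_path_lifts ⟨φ, cφ⟩ g hg
  have hG (t) : (QuotientGroup.mk (G t) : PSpPM n) = φ t := congrFun hG t
  have cval : Continuous fun t => (G t).1.val := SpPM.continuous_val.comp G.continuous
  have hne := one_ne_neg_one_matrix hn
  have hsq (t) : (G t).1.val * (G t).1.val = 1 := by
    refine eq_left_of_forall_eq_or_eq (f := fun t => (G t).1.val * (G t).1.val) (cval.mul cval) hne
      (fun t => ?_) (x₀ := 0) (by rw [hG₀, hg₁]) t
    refine val_eq_or_of_mk_eq_one (g := G t * G t) ?_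
    rw [QuotientGroup.mk_mul, hG, hφ]
  refine ⟨G, G.continuous, hG₀, hG, hsq, fun t => ?_⟩
  have hadj : symplAdj n (G t).1.val * (G t).1.val = -1 := by
    refine eq_left_of_forall_eq_or_eq (f := fun t => symplAdj n (G t).1.val * (G t).1.val)
      ((continuous_symplAdj.comp cval).mul cval) hne.symm
      (fun t => ((mem_SpPM_iff _).mp (G t).2).symm) (x₀ := 0) ?_ t
    rw [hG₀, hg₂, neg_mul, hg₁]
  calc symplAdj n (G t).1.val
      = symplAdj n (G t).1.val * ((G t).1.val * (G t).1.val) := by rw [hsq, mul_one]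
    _ = -(G t).1.val := by rw [← mul_assoc, hadj, neg_one_mul]

theorem pow_two_mul_eq_one_of_mk {n : ℕ} {g : SpPM n} {k : ℕ}
    (h : (QuotientGroup.mk g : PSpPM n) ^ k = 1) : g.1.val ^ (2 * k) = 1 := by
  have := val_eq_or_of_mk_eq_one (g := g ^ k) (by rw [QuotientGroup.mk_pow, h])
  simp only [SubgroupClass.coe_pow, Units.val_pow_eq_pow_val] at this
  rcases this with h | h <;> simp [mul_comm 2 k, pow_mul, h]

theorem exists_SpPM_of_symplAdj_mul_eq_one {n : ℕ} {X : Matrix (Fin n ⊕ Fin n) (Fin n ⊕ Fin n) ℝ}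
    (h : symplAdj n X * X = 1) : ∃ g : SpPM n, g.1.val = X :=
  ⟨⟨⟨X, symplAdj n X, mul_eq_one_comm.mp h, h⟩, (mem_SpPM_iff _).mpr (Or.inl h)⟩, rfl⟩

theorem mk_eq_conj_of_val_mul_eq {n : ℕ} {g g₀ h : SpPM n}
    (e : g.1.val * h.1.val = h.1.val * g₀.1.val) :
    (QuotientGroup.mk g : PSpPM n)
      = QuotientGroup.mk h * QuotientGroup.mk g₀ * (QuotientGroup.mk h)⁻¹ := by
  have : g * h = h * g₀ := Subtype.ext (Units.ext e)
  rw [eq_mul_inv_iff_mul_eq, ← QuotientGroup.mk_mul, ← QuotientGroup.mk_mul, this]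

theorem stmt1 (n : ℕ) (hn : 1 ≤ n) (k1 k2 k3 : ℕ)
    (hk1 : 2 ≤ k1) (hk2 : 2 ≤ k2) (hk3 : 2 ≤ k3)
    (hhyp : (1:ℝ)/k1 + 1/k2 + 1/k3 < 1)
    -- the six Lagrangian subspaces `L i b` (`i` indexing the pairs, `b` the sign)
    (L : Fin 3 → Bool → Submodule ℝ (SpV n))
    (hlag : ∀ i b, IsLagrangian n (L i b))
    (htrans : ∀ i b j b', (i, b) ≠ (j, b') → IsCompl (L i b) (L j b'))
    -- the cross-ratios are the scalars `sin²(π/(2kᵢ))`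
    (hcr1 : ∀ (h : IsCompl (L 1 true) (L 1 false)) (h' : IsCompl (L 2 true) (L 2 false)),
      crossRatio (L 1 true) (L 1 false) (L 2 true) (L 2 false) h h'
        = (Real.sin (Real.pi / (2 * k1)) ^ 2) • LinearMap.id)
    (hcr2 : ∀ (h : IsCompl (L 0 true) (L 0 false)) (h' : IsCompl (L 2 true) (L 2 false)),
      crossRatio (L 0 true) (L 0 false) (L 2 true) (L 2 false) h h'
        = (Real.sin (Real.pi / (2 * k2)) ^ 2) • LinearMap.id)
    (hcr3 : ∀ (h : IsCompl (L 0 true) (L 0 false)) (h' : IsCompl (L 1 true) (L 1 false)),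
      crossRatio (L 0 true) (L 0 false) (L 1 true) (L 1 false) h h'
        = (Real.sin (Real.pi / (2 * k3)) ^ 2) • LinearMap.id)
    -- `ρ0` sends the generators to the classes of the Lagrangian reflections
    (ρ0 : TriangleGroup k1 k2 k3 →* PSpPM n)
    (hρ0 : ∀ (i : Fin 3) (h : IsCompl (L i true) (L i false)),
      ∃ g : SpPM n, ((g : GL (Fin n ⊕ Fin n) ℝ) : Matrix (Fin n ⊕ Fin n) (Fin n ⊕ Fin n) ℝ)
            = LinearMap.toMatrix' (reflPair (L i true) (L i false) h) ∧
        ρ0 (PresentedGroup.of i) = QuotientGroup.mk g)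
    -- a continuous family of homomorphisms starting at `ρ0`
    (ρ : Set.Icc (0:ℝ) 1 → (TriangleGroup k1 k2 k3 →* PSpPM n))
    (hcont : ∀ γ : TriangleGroup k1 k2 k3, Continuous fun t => ρ t γ)
    (hstart : ρ ⟨0, by norm_num⟩ = ρ0) :
    -- every `ρ t` is conjugate to `ρ0` by an element of `Sp^±(2n,ℝ)`
    ∀ t, ∃ h : SpPM n, ∀ γ,
      ρ t γ = QuotientGroup.mk h * ρ0 γ * (QuotientGroup.mk h)⁻¹ := by
  have hcompl (i : Fin 3) : IsCompl (L i true) (L i false) := htrans i true i false (by simp)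
  have hrel (t) {r : FreeGroup (Fin 3)} (hr : r ∈ triangleRels k1 k2 k3) :
      ρ t (PresentedGroup.mk _ r) = 1 := by
    rw [PresentedGroup.one_of_mem hr, map_one]
  have hinvol (i : Fin 3) (t) : ρ t (.of i) * ρ t (.of i) = 1 := by
    rw [← pow_two, ← map_pow]
    refine hrel t (r := FreeGroup.of i ^ 2) ?_
    fin_cases i <;> simp [triangleRels]
  choose g hg hg' using fun i => hρ0 i (hcompl i)
  have hlift (i : Fin 3) := exists_lift_of_involutions hn (hcont (.of i)) (hinvol i) (g := g i)
    ((DFunLike.congr_fun hstart _).trans (hg' i)) (by rw [hg, toMatrix_reflPair_mul_self])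
    (by rw [hg, symplAdj_toMatrix_reflPair (hlag i true) (hlag i false)])
  choose G cG hG₀ hG hsq hadj using hlift
  have cM (i : Fin 3) : Continuous fun t => (G i t).1.val := SpPM.continuous_val.comp (cG i)
  have hpow {i j : Fin 3} {k : ℕ}
      (hr : (FreeGroup.of i * FreeGroup.of j) ^ k ∈ triangleRels k1 k2 k3) (t) :
      ((G i t).1.val * (G j t).1.val) ^ (2 * k) = 1 := by
    refine pow_two_mul_eq_one_of_mk (g := G i t * G j t) ?_
    rw [QuotientGroup.mk_mul, hG, hG, ← map_mul, ← map_pow]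
    exact hrel t hr
  have hanti {i j : Fin 3} {k l : ℕ} (hk : 2 ≤ k)
      (hr : (FreeGroup.of i * FreeGroup.of j) ^ k ∈ triangleRels k1 k2 k3)
      (hcr : crossRatio (L i true) (L i false) (L j true) (L j false) (hcompl i) (hcompl j)
        = (Real.sin (Real.pi / (2 * l)) ^ 2) • LinearMap.id) (t) :
      (G i t).1.val * (G j t).1.val + (G j t).1.val * (G i t).1.val
        = (2 * -Real.cos (Real.pi / l)) • 1 := by
    refine anticomm_const (cM i) (cM j) (hsq i) (hsq j) (by omega) (hpow hr) (y₀ := 0) ?_ t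
    rw [hG₀, hG₀, hg, hg, toMatrix_reflPair_anticomm (hlag i true) (hlag i false) (hlag j true)
      (hlag j false) _ _ hcr, two_mul_sin_sq_half_sub_one]
  have hAB := hanti (i := 0) (j := 1) hk1 (by simp [triangleRels]) (hcr3 _ _)
  have hAC := hanti (i := 0) (j := 2) hk3 (by simp [triangleRels]) (hcr2 _ _)
  have hBC := hanti (i := 1) (j := 2) hk2 (by simp [triangleRels]) (hcr1 _ _)
  have hangle {k : ℕ} (hk : 2 ≤ k) : 0 < Real.pi / k := by positivity
  have hsum : Real.pi / k3 + Real.pi / k2 + Real.pi / k1 < Real.pi := by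
    have := mul_lt_mul_of_pos_left hhyp Real.pi_pos
    calc Real.pi / k3 + Real.pi / k2 + Real.pi / k1
        = Real.pi * (1 / k1 + 1 / k2 + 1 / k3) := by ring
      _ < Real.pi := by linarith
  have hp : 1 - (-Real.cos (Real.pi / k3)) ^ 2 ≠ 0 := by
    rw [neg_sq, ← Real.sin_sq]
    refine pow_ne_zero 2 (Real.sin_pos_of_pos_of_lt_pi (hangle hk3) ?_).ne'
    linarith [hangle hk1, hangle hk2]
  have hD := gram_det_neg (hangle hk3) (hangle hk2) (hangle hk1) hsum
  intro t
  obtain ⟨X, hX, hX₀, hX₁, hX₂⟩ := exists_conj_of_involutions (cM 0) (cM 1) (cM 2) (hsq 0) (hsq 1)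
    (hsq 2) (hadj 0) (hadj 1) (hadj 2) hAB hAC hBC hp (by linarith) 0 t
  obtain ⟨h, rfl⟩ := exists_SpPM_of_symplAdj_mul_eq_one hX
  have hconj : ρ t = (MulAut.conj (QuotientGroup.mk h : PSpPM n)).toMonoidHom.comp ρ0 := by
    refine PresentedGroup.ext fun i => ?_
    have hi : (G i t).1.val * h.1.val = h.1.val * (G i 0).1.val := by
      fin_cases i
      exacts [hX₀, hX₁, hX₂]
    rw [← hG, mk_eq_conj_of_val_mul_eq hi, hG₀, ← hg']
    rfl
  exact ⟨h, fun γ => DFunLike.congr_fun hconj γ⟩
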